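/- Let Σ = {a,b}, let w ∈ Σ* be a word of length n with w ∉ {a^{n-1}b, ab^{n-1}, ba^{n-1}, b^{n-1}a}, and let L = Σ* w Σ*. Then the syntactic complexity of L satisfies σ(L) = n² + 1 + N(w), where N(w) is the number of distinct inner factors of w. -/

import Mathlib

/-- The two-letter alphabet Σ = {a, b}. -/
inductive Letter : Type
  | a : Letter
  | b : Letter
deriving DecidableEq

/-- The syntactic (Myhill) congruence of a language L, as a setoid on Σ⁺. -/
def synSetoid (L : Set (List Letter)) : Setoid {u : List Letter // u ≠ []} where
  r u v := ∀ x y : List Letter, x ++ u.val ++ y ∈ L ↔ x ++ v.val ++ y ∈ L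
  iseqv := ⟨fun _ _ _ => Iff.rfl, fun h x y => (h x y).symm,
    fun h1 h2 x y => (h1 x y).trans (h2 x y)⟩

/-- The syntactic complexity of L: the cardinality of its syntactic semigroup Σ⁺/≈_L. -/
noncomputable def syntacticComplexity (L : Set (List Letter)) : ℕ :=
  Nat.card (Quotient (synSetoid L))

/-- The language Σ* w Σ* of all words containing w as a factor. -/
def factorLang (w : List Letter) : Set (List Letter) := {u : List Letter | w <:+: u}

/-- The set of inner factors of w: nonempty words u with w = t u s for nonempty t, s. -/
def innerFactors (w : List Letter) : Set (List Letter) :=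
  {u : List Letter | u ≠ [] ∧ ∃ t s : List Letter, t ≠ [] ∧ s ≠ [] ∧ w = t ++ u ++ s}

namespace SynFactor

variable {α : Type}

/-- Syntactic equivalence on plain lists. -/
def Syn (w u v : List α) : Prop := ∀ x y : List α, w <:+: x ++ u ++ y ↔ w <:+: x ++ v ++ y

theorem Syn.symm {w u v : List α} (h : Syn w u v) : Syn w v u := fun x y => (h x y).symm

theorem Syn.rev {w u v : List α} (h : Syn w u v) : Syn w.reverse u.reverse v.reverse := by
  intro x y
  have := h y.reverse x.reverse
  rw [← List.reverse_infix, ← List.reverse_infix (l₂ := y.reverse ++ v ++ x.reverse)] at this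
  simpa [List.append_assoc] using this

theorem suf_app {l x u : List α} (h : l <:+ x ++ u) :
    l <:+ u ∨ ∃ t, t ≠ [] ∧ l = t ++ u ∧ t <:+ x := by
  obtain ⟨r, hr⟩ := h
  rcases List.append_eq_append_iff.mp hr with ⟨a, h1, h2⟩ | ⟨a, h1, h2⟩
  · by_cases ha : a = []
    · left; subst ha; simp at h2; subst h2; exact List.suffix_refl _
    · right; exact ⟨a, ha, h2, ⟨r, h1.symm⟩⟩
  · left; exact ⟨a, h2.symm⟩

theorem split3 {w x u y : List α} (h : w <:+: x ++ u ++ y) :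
    w <:+: x ∨ w <:+: y ∨ w <:+: u ∨ (∃ a b, a ≠ [] ∧ w = a ++ b ∧ a <:+ x ∧ b <+: u) ∨
    (∃ a b, b ≠ [] ∧ w = a ++ b ∧ a <:+ u ∧ b <+: y) ∨
    (∃ t s, t ≠ [] ∧ s ≠ [] ∧ w = t ++ u ++ s ∧ t <:+ x ∧ s <+: y) := by
  rcases List.infix_append_iff.mp h with h | h | ⟨a, b, h, ha, hb⟩
  · rcases List.infix_append_iff.mp h with h | h | ⟨a, b, h, ha, hb⟩
    · tauto
    · tauto
    · by_cases hn : a = []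
      · subst hn; simp at h; subst h
        right; right; left; exact hb.isInfix
      · right; right; right; left; exact ⟨a, b, hn, h, ha, hb⟩
  · tauto
  · by_cases hn : b = []
    · subst hn; simp at h; subst h
      rcases suf_app ha with h | ⟨t, ht, h, htx⟩
      · right; right; left; exact h.isInfix
      · right; right; right; left; exact ⟨t, u, ht, h, htx, List.prefix_refl _⟩
    · rcases suf_app ha with h' | ⟨t, ht, h', htx⟩
      · right; right; right; right; left; exact ⟨a, b, hn, h, h', hb⟩
      · right; right; right; right; right; exact ⟨t, b, ht, hn, by rw [h, h'], htx, hb⟩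

open Classical in
/-- Length of the longest suffix of `u` which is a proper prefix of `w`. -/
noncomputable def pl (w u : List α) : ℕ :=
  Nat.findGreatest (fun k => w.take k <:+ u) (w.length - 1)

theorem pl_lt {w : List α} (hw : w ≠ []) (u : List α) : pl w u < w.length := by
  classical
  have : pl w u ≤ w.length - 1 := by
    unfold pl
    exact Nat.findGreatest_le _
  have := List.length_pos_iff.mpr hw
  omega

theorem pl_spec (w u : List α) : w.take (pl w u) <:+ u := by
  classical
  unfold pl
  exact Nat.findGreatest_spec (P := fun k => w.take k <:+ u) (m := 0) (Nat.zero_le _) (by simp)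

theorem pl_max {w u t : List α} (h1 : t <+: w) (h2 : t <:+ u) (h3 : t.length < w.length) :
    t.length ≤ pl w u := by
  classical
  unfold pl
  refine Nat.le_findGreatest (by omega) ?_
  rw [← List.prefix_iff_eq_take.mp h1]; exact h2

theorem pl_le {w : List α} (hw : w ≠ []) (u : List α) : pl w u ≤ u.length := by
  have h := (pl_spec w u).length_le
  have := pl_lt hw u
  rw [List.length_take] at h
  omega

theorem pl_transfer {w u v t : List α} (h : pl w u = pl w v)
    (h1 : t <+: w) (h2 : t <:+ u) (h3 : t.length < w.length) : t <:+ v := by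
  have hm := pl_max h1 h2 h3
  have hs := List.suffix_of_suffix_length_le h2 (pl_spec w u) (by
    rw [List.length_take]; omega)
  rw [h] at hs
  exact hs.trans (pl_spec w v)

theorem not_syn_of_lt {w u v : List α} (hw : w ≠ []) (hv : ¬ w <:+: v)
    (hlt : pl w v < pl w u) : ¬ Syn w u v := by
  intro h
  have hl := pl_lt hw u
  have h1 : w <:+: [] ++ u ++ w.drop (pl w u) := by
    obtain ⟨r, hr⟩ := pl_spec w u
    refine ⟨r, [], ?_⟩
    generalize pl w u = k at *
    subst hr
    simp
  rw [h] at h1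
  simp only [List.nil_append] at h1
  rcases List.infix_append_iff.mp h1 with h | h | ⟨a, b, h, ha, hb⟩
  · exact hv h
  · have := h.length_le
    rw [List.length_drop] at this
    omega
  · have h2 := hb.length_le
    have h3 := congrArg List.length h
    rw [List.length_drop] at h2
    rw [List.length_append] at h3
    by_cases hb0 : b = []
    · subst hb0; simp at h; subst h; exact hv ha.isInfix
    · have := List.length_pos_iff.mpr hb0
      have := pl_max ⟨b, h.symm⟩ ha (by omega)
      omega

theorem pl_eq_of_syn {w u v : List α} (hw : w ≠ []) (hu : ¬ w <:+: u) (hv : ¬ w <:+: v)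
    (h : Syn w u v) : pl w u = pl w v := by
  rcases lt_trichotomy (pl w u) (pl w v) with h1 | h1 | h1
  · exact absurd h.symm (not_syn_of_lt hw hu h1)
  · exact h1
  · exact absurd h (not_syn_of_lt hw hv h1)

/-- Length of the longest prefix of `u` which is a proper suffix of `w`. -/
noncomputable def sl (w u : List α) : ℕ := pl w.reverse u.reverse

theorem sl_lt {w : List α} (hw : w ≠ []) (u : List α) : sl w u < w.length := by
  have := pl_lt (w := w.reverse) (by simpa using hw) u.reverse
  simpa [sl] using this

theorem sl_le {w : List α} (hw : w ≠ []) (u : List α) : sl w u ≤ u.length := by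
  have := pl_le (w := w.reverse) (by simpa using hw) u.reverse
  simpa [sl] using this

theorem sl_max {w u t : List α} (h1 : t <:+ w) (h2 : t <+: u) (h3 : t.length < w.length) :
    t.length ≤ sl w u := by
  have := pl_max (List.reverse_prefix.mpr h1) (List.reverse_suffix.mpr h2) (by simpa using h3)
  simpa [sl] using this

theorem sl_transfer {w u v t : List α} (h : sl w u = sl w v)
    (h1 : t <:+ w) (h2 : t <+: u) (h3 : t.length < w.length) : t <+: v := by
  have := pl_transfer h (List.reverse_prefix.mpr h1) (List.reverse_suffix.mpr h2)
    (by simpa using h3)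
  simpa using this

theorem sl_eq_of_syn {w u v : List α} (hw : w ≠ []) (hu : ¬ w <:+: u) (hv : ¬ w <:+: v)
    (h : Syn w u v) : sl w u = sl w v :=
  pl_eq_of_syn (by simpa using hw) (by simpa using hu) (by simpa using hv) h.rev

/-- Inner factors, without nonemptiness. -/
def Inner (w u : List α) : Prop := ∃ t s : List α, t ≠ [] ∧ s ≠ [] ∧ w = t ++ u ++ s

theorem Inner.len {w u : List α} (h : Inner w u) : u.length + 2 ≤ w.length := by
  obtain ⟨t, s, ht, hs, rfl⟩ := h
  have := List.length_pos_iff.mpr ht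
  have := List.length_pos_iff.mpr hs
  simp; omega

theorem Inner.not_mem {w u : List α} (h : Inner w u) : ¬ w <:+: u := by
  intro h'
  have := h.len
  have := h'.length_le
  omega

theorem syn_half {w u v : List α} (hu : ¬ w <:+: u) (hi : ¬ Inner w u)
    (hp : pl w u = pl w v) (hs : sl w u = sl w v) (x y : List α)
    (h0 : w <:+: x ++ u ++ y) : w <:+: x ++ v ++ y := by
  rcases split3 h0 with h | h | h | ⟨a, b, hn, h, ha, hb⟩ | ⟨a, b, hn, h, ha, hb⟩ |
    ⟨t, s, ht, hs, h, _⟩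
  · exact h.trans ⟨[], v ++ y, by simp⟩
  · exact h.trans ⟨x ++ v, [], by simp⟩
  · exact absurd h hu
  · have hl := congrArg List.length h
    have := List.length_pos_iff.mpr hn
    rw [List.length_append] at hl
    have hb' := sl_transfer hs ⟨a, h.symm⟩ hb (by omega)
    obtain ⟨r, rfl⟩ := ha
    obtain ⟨q, rfl⟩ := hb'
    exact ⟨r, q ++ y, by rw [h]; simp⟩
  · have hl := congrArg List.length h
    have := List.length_pos_iff.mpr hn
    rw [List.length_append] at hl
    have ha' := pl_transfer hp ⟨b, h.symm⟩ ha (by omega)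
    obtain ⟨r, rfl⟩ := ha'
    obtain ⟨q, rfl⟩ := hb
    exact ⟨x ++ r, q, by rw [h]; simp⟩
  · exact absurd ⟨t, s, ht, hs, h⟩ hi

theorem syn_of_eq {w u v : List α} (hu : ¬ w <:+: u) (hi : ¬ Inner w u)
    (hv : ¬ w <:+: v) (hj : ¬ Inner w v)
    (hp : pl w u = pl w v) (hs : sl w u = sl w v) : Syn w u v :=
  fun x y => ⟨syn_half hu hi hp hs x y, syn_half hv hj hp.symm hs.symm x y⟩

theorem syn_of_mem {w u v : List α} (hu : w <:+: u) (hv : w <:+: v) : Syn w u v :=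
  fun x y => ⟨fun _ => hv.trans ⟨x, y, rfl⟩, fun _ => hu.trans ⟨x, y, rfl⟩⟩

theorem mem_of_syn {w u v : List α} (h : Syn w u v) (hu : w <:+: u) : w <:+: v := by
  have := (h [] []).mp (by simpa using hu)
  simpa using this

theorem inner_aux {w u v : List α} (hw : w ≠ []) (hu : Inner w u) (hv : ¬ w <:+: v)
    (h : Syn w u v) : Inner w v ∧ (v.length ≤ u.length → u = v) := by
  have hp := pl_eq_of_syn hw hu.not_mem hv h
  have hs := sl_eq_of_syn hw hu.not_mem hv h
  have hpu := pl_le hw u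
  have hsu := sl_le hw u
  obtain ⟨t, s, ht, hs0, hwe⟩ := hu
  have h1 : w <:+: t ++ v ++ s := (h t s).mp (by rw [hwe])
  have hl := congrArg List.length hwe
  have ht' := List.length_pos_iff.mpr ht
  have hs' := List.length_pos_iff.mpr hs0
  simp only [List.length_append] at hl
  rcases split3 h1 with h | h | h | ⟨a, b, hn, h, ha, hb⟩ | ⟨a, b, hn, h, ha, hb⟩ |
    ⟨t', s', ht1, hs1, h, ht2, hs2⟩
  · have := h.length_le; omega
  · have := h.length_le; omega
  · exact absurd h hv
  · have hl' := congrArg List.length h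
    have := List.length_pos_iff.mpr hn
    have := ha.length_le
    rw [List.length_append] at hl'
    have := sl_max ⟨a, h.symm⟩ hb (by omega)
    omega
  · have hl' := congrArg List.length h
    have := List.length_pos_iff.mpr hn
    have := hb.length_le
    rw [List.length_append] at hl'
    have := pl_max ⟨b, h.symm⟩ ha (by omega)
    omega
  · refine ⟨⟨t', s', ht1, hs1, h⟩, fun hle => ?_⟩
    have hl' := congrArg List.length h
    simp only [List.length_append] at hl'
    have := ht2.length_le
    have := hs2.length_le
    have e1 : t' = t := ht2.eq_of_length (by omega)
    have e2 : s' = s := hs2.eq_of_length (by omega)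
    subst e1 e2
    rw [hwe] at h
    simpa using h

theorem inner_eq {w u v : List α} (hw : w ≠ []) (hu : Inner w u) (hv : ¬ w <:+: v)
    (h : Syn w u v) : u = v := by
  obtain ⟨h1, h2⟩ := inner_aux hw hu hv h
  rcases le_total v.length u.length with hle | hle
  · exact h2 hle
  · exact ((inner_aux hw h1 hu.not_mem h.symm).2 hle).symm

/-- A separator word for `w`. -/
structure Sep (w z : List α) : Prop where
  len : w.length ≤ z.length
  nmem : ¬ w <:+: z
  left : ∀ t, t ≠ [] → t <:+ z → t <+: w → False
  right : ∀ t, t ≠ [] → t <+: z → t <:+ w → False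

theorem Sep.rev {w z : List α} (h : Sep w z) : Sep w.reverse z.reverse where
  len := by simpa using h.len
  nmem := by simpa using h.nmem
  left t h0 h1 h2 := h.right t.reverse (by simpa using h0)
    (by rw [← List.reverse_suffix]; simpa using h1) (by rw [← List.reverse_prefix]; simpa using h2)
  right t h0 h1 h2 := h.left t.reverse (by simpa using h0)
    (by rw [← List.reverse_prefix]; simpa using h1) (by rw [← List.reverse_suffix]; simpa using h2)

theorem sep_pl {w z : List α} (hz : Sep w z) (A : List α) {i : ℕ} (hi : i < w.length) :
    pl w (A ++ z ++ w.take i) = i := by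
  have hw : w ≠ [] := by rintro rfl; simp at hi
  apply le_antisymm
  · by_contra hlt
    push Not at hlt
    have hsp := pl_spec w (A ++ z ++ w.take i)
    have hll := pl_lt hw (A ++ z ++ w.take i)
    generalize pl w (A ++ z ++ w.take i) = k at *
    rcases suf_app hsp with h | ⟨t, ht, h, htx⟩
    · have := h.length_le
      simp at this; omega
    · have htw : t <+: w := (List.prefix_append t _).trans (h ▸ List.take_prefix k w)
      refine hz.left t ht ?_ htw
      refine List.suffix_of_suffix_length_le htx (List.suffix_append A z) ?_
      exact htw.length_le.trans hz.len
  · have := pl_max (u := A ++ z ++ w.take i) (List.take_prefix i w) (List.suffix_append _ _)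
      (by simp; omega)
    simpa [Nat.min_eq_left hi.le] using this

theorem sep_sl {w z : List α} (hz : Sep w z) (B : List α) {j : ℕ} (hj : j < w.length) :
    sl w (w.drop (w.length - j) ++ z ++ B) = j := by
  have := sep_pl hz.rev B.reverse (i := j) (by simpa using hj)
  have e : w.length - (w.length - j) = j := by omega
  unfold sl
  simp only [List.reverse_append, List.reverse_drop, e]
  simpa only [List.append_assoc] using this

theorem sep_nmem {w z : List α} (hz : Sep w z) {i j : ℕ} (hi : i < w.length)
    (hj : j < w.length) : ¬ w <:+: w.drop (w.length - j) ++ z ++ w.take i := by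
  intro h
  rcases List.infix_append_iff.mp h with h | h | ⟨a, b, h, ha, hb⟩
  · rcases List.infix_append_iff.mp h with h | h | ⟨a, b, h, ha, hb⟩
    · have := h.length_le
      simp at this; omega
    · exact hz.nmem h
    · have hl := congrArg List.length h
      have := ha.length_le
      simp at this hl
      refine hz.right b ?_ hb ⟨a, h.symm⟩
      rintro rfl
      simp at hl; omega
  · have := h.length_le
    simp at this; omega
  · have hl := congrArg List.length h
    have := hb.length_le
    simp at this hl
    refine hz.left a ?_ ?_ ⟨b, h.symm⟩
    · rintro rfl
      simp at hl; omega
    · refine List.suffix_of_suffix_length_le ha (List.suffix_append _ z) ?_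
      have := hz.len
      omega

theorem card_main {w : List α} (hw : w ≠ []) {z : List α} (hz : Sep w z)
    (S : Setoid {u : List α // u ≠ []}) (hS : ∀ u v, S.r u v ↔ Syn w u.1 v.1)
    (I : Set (List α)) (hI : ∀ u, u ∈ I ↔ u ≠ [] ∧ Inner w u) :
    Nat.card (Quotient S) = w.length ^ 2 + 1 + I.ncard := by
  classical
  have hfin : I.Finite := by
    refine (w.sublists.toFinset.finite_toSet).subset ?_
    intro u hu
    obtain ⟨-, t, s, -, -, h⟩ := (hI u).mp hu
    have : u <:+: w := ⟨t, s, h.symm⟩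
    simpa using this.sublist
  let f : {u : List α // u ≠ []} → Option (I ⊕ (Fin w.length × Fin w.length)) := fun u =>
    if w <:+: u.1 then none
    else if h : u.1 ∈ I then some (Sum.inl ⟨u.1, h⟩)
    else some (Sum.inr (⟨pl w u.1, pl_lt hw _⟩, ⟨sl w u.1, sl_lt hw _⟩))
  have hker : S = Setoid.ker f := by
    ext u v
    change S.r u v ↔ f u = f v
    rw [hS]
    by_cases hu : w <:+: u.1
    · by_cases hv : w <:+: v.1
      · simp [f, hu, hv, syn_of_mem hu hv]
      · have : ¬ Syn w u.1 v.1 := fun h => hv (mem_of_syn h hu)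
        simp only [this, false_iff, f, hu, hv, if_true, if_false]
        split_ifs <;> simp
    · by_cases hv : w <:+: v.1
      · have : ¬ Syn w u.1 v.1 := fun h => hu (mem_of_syn h.symm hv)
        simp only [this, false_iff, f, hu, hv, if_true, if_false]
        split_ifs <;> simp
      · have key : Syn w u.1 v.1 → (u.1 ∈ I ∨ v.1 ∈ I) → u.1 = v.1 := by
          rintro h (h1 | h1)
          · exact inner_eq hw ((hI _).mp h1).2 hv h
          · exact (inner_eq hw ((hI _).mp h1).2 hu h.symm).symm
        by_cases hui : u.1 ∈ I <;> by_cases hvi : v.1 ∈ I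
        · simp only [f, hu, hv, hui, hvi, if_false, dif_pos, Option.some.injEq, Sum.inl.injEq,
            Subtype.mk.injEq]
          exact ⟨fun h => key h (Or.inl hui), fun h => by rw [h]; exact fun _ _ => Iff.rfl⟩
        · simp only [f, hu, hv, hui, hvi, if_false, dif_pos, dif_neg, not_false_eq_true]
          simp only [Option.some.injEq, reduceCtorEq, iff_false]
          intro h
          exact hvi (key h (Or.inl hui) ▸ hui)
        · simp only [f, hu, hv, hui, hvi, if_false, dif_pos, dif_neg, not_false_eq_true]
          simp only [Option.some.injEq, reduceCtorEq, iff_false]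
          intro h
          exact hui (key h (Or.inr hvi) ▸ hvi)
        · simp only [f, hu, hv, hui, hvi, if_false, dif_neg, not_false_eq_true,
            Option.some.injEq, Sum.inr.injEq, Prod.mk.injEq, Fin.mk.injEq]
          constructor
          · intro h
            exact ⟨pl_eq_of_syn hw hu hv h, sl_eq_of_syn hw hu hv h⟩
          · rintro ⟨h1, h2⟩
            exact syn_of_eq hu (fun h => hui ((hI _).mpr ⟨u.2, h⟩)) hv
              (fun h => hvi ((hI _).mpr ⟨v.2, h⟩)) h1 h2
  have hsurj : Function.Surjective f := by
    rintro (_ | ⟨u, hu⟩ | ⟨⟨i, hi⟩, ⟨j, hj⟩⟩)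
    · exact ⟨⟨w, hw⟩, by simp [f]⟩
    · have h := (hI u).mp hu
      exact ⟨⟨u, h.1⟩, by simp [f, hu, h.2.not_mem]⟩
    · have hzl := hz.len
      have hwl := List.length_pos_iff.mpr hw
      refine ⟨⟨w.drop (w.length - j) ++ z ++ w.take i, ?_⟩, ?_⟩
      · intro h
        have := congrArg List.length h
        simp only [List.length_append, List.length_nil] at this
        omega
      · have hn : w.drop (w.length - j) ++ z ++ w.take i ∉ I := by
          intro h
          have := ((hI _).mp h).2.len
          simp only [List.length_append] at this
          omega
        simp only [f, sep_nmem hz hi hj, hn, if_false, dif_neg, not_false_eq_true]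
        simp only [sep_pl hz _ hi, sep_sl hz _ hj]
  subst hker
  have : Finite I := hfin
  rw [Nat.card_congr (Setoid.quotientKerEquivOfSurjective f hsurj), Finite.card_option,
    Nat.card_sum, Nat.card_prod, Nat.card_fin, Nat.card_coe_set_eq]
  ring

/-! ### Existence of separators -/

theorem sep_same {c d : α} (hcd : c ≠ d) {w : List α} (h1 : [c] <+: w) (h2 : [c] <:+ w) :
    Sep w (List.replicate w.length d) where
  len := by simp
  nmem h := by
    have := h1.isInfix.trans h
    have : c ∈ List.replicate w.length d := this.subset (by simp)
    exact hcd (List.eq_of_mem_replicate this)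
  left t ht hz hw := by
    have := List.prefix_of_prefix_length_le h1 hw (List.length_pos_iff.mpr ht)
    have : c ∈ List.replicate w.length d := hz.subset (this.subset (by simp))
    exact hcd (List.eq_of_mem_replicate this)
  right t ht hz hw := by
    have := List.suffix_of_suffix_length_le h2 hw (List.length_pos_iff.mpr ht)
    have : c ∈ List.replicate w.length d := hz.subset (this.subset (by simp))
    exact hcd (List.eq_of_mem_replicate this)

theorem sep_diff_left {c d : α} (hcd : c ≠ d) {w : List α} (h1 : [c] <+: w)
    (t : List α) (ht : t ≠ [])
    (hz : t <:+ List.replicate w.length c ++ List.replicate w.length d) (hw : t <+: w) :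
    False := by
  rcases suf_app hz with h | ⟨s, hs, h, _⟩
  · have := List.prefix_of_prefix_length_le h1 hw (List.length_pos_iff.mpr ht)
    have : c ∈ List.replicate w.length d := h.subset (this.subset (by simp))
    exact hcd (List.eq_of_mem_replicate this)
  · have h3 := hw.length_le
    have := List.length_pos_iff.mpr hs
    rw [h, List.length_append, List.length_replicate] at h3
    omega

theorem sep_diff {c d : α} (hcd : c ≠ d) {w : List α} (h1 : [c] <+: w) (h2 : [d] <:+ w)
    (hn : ∀ p q, w ≠ List.replicate p c ++ List.replicate q d) :
    Sep w (List.replicate w.length c ++ List.replicate w.length d) where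
  len := by simp
  nmem h := by
    rcases List.infix_append_iff.mp h with h | h | ⟨a, b, h, ha, hb⟩
    · exact hn w.length 0 (by simpa using (List.infix_replicate_iff.mp h).2)
    · exact hn 0 w.length (by simpa using (List.infix_replicate_iff.mp h).2)
    · refine hn a.length b.length ?_
      rw [← (List.suffix_replicate_iff.mp ha).2, ← (List.prefix_replicate_iff.mp hb).2]
      exact h
  left := sep_diff_left hcd h1
  right t ht hz hw := by
    refine sep_diff_left (w := w.reverse) hcd.symm ?_ t.reverse (by simpa using ht) ?_ ?_
    · simpa using List.reverse_prefix.mpr h2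
    · simpa using List.reverse_suffix.mpr hz
    · simpa using hw

/-- The word `(cd)^m`. -/
def alt (c d : α) : ℕ → List α
  | 0 => []
  | m + 1 => c :: d :: alt c d m

theorem alt_len (c d : α) (m : ℕ) : (alt c d m).length = 2 * m := by
  induction m with
  | zero => rfl
  | succ m ih => simp [alt, ih]; ring

theorem alt_cc {c d : α} (hcd : c ≠ d) (m : ℕ) : ¬ [c, c] <:+: alt c d m := by
  induction m with
  | zero => simp [alt]
  | succ m ih => simp [alt, List.infix_cons_iff, ih, hcd]

theorem alt_append (c d : α) (m : ℕ) : alt c d m ++ [c, d] = c :: d :: alt c d m := by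
  induction m with
  | zero => rfl
  | succ m ih => simp [alt, ih]

theorem alt_rev (c d : α) (m : ℕ) : (alt c d m).reverse = alt d c m := by
  induction m with
  | zero => rfl
  | succ m ih => simp [alt, ih, alt_append]

theorem alt_left {c d : α} (hcd : c ≠ d) {w : List α} (m : ℕ) (h1 : [c, c] <+: w)
    (t : List α) (ht : t ≠ []) (hz : t <:+ alt c d m) (hw : t <+: w) : False := by
  rcases le_total t.length 1 with hl | hl
  · have e : t = [c] := by
      have := List.length_pos_iff.mpr ht
      have h3 : [c] <+: w := List.IsPrefix.trans ⟨[c], rfl⟩ h1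
      exact (List.prefix_of_prefix_length_le hw h3 (by simpa using hl)).eq_of_length
        (by simp; omega)
    subst e
    rw [← List.reverse_prefix, alt_rev] at hz
    cases m with
    | zero => simp [alt] at hz
    | succ m => simp [alt, hcd] at hz
  · rcases Nat.lt_or_ge t.length 2 with hl2 | hl2
    · have e : t = [c] := by
        have h3 : [c] <+: w := List.IsPrefix.trans ⟨[c], rfl⟩ h1
        exact (List.prefix_of_prefix_length_le hw h3 (by simp; omega)).eq_of_length
          (by simp; omega)
      subst e
      rw [← List.reverse_prefix, alt_rev] at hz
      cases m with
      | zero => simp [alt] at hz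
      | succ m => simp [alt, hcd] at hz
    · have := List.prefix_of_prefix_length_le h1 hw hl2
      exact alt_cc hcd m (this.isInfix.trans hz.isInfix)

theorem sep_alt {c d : α} (hcd : c ≠ d) {w : List α} (h1 : [c, c] <+: w) (h2 : [d, d] <:+ w) :
    Sep w (alt c d w.length) where
  len := by rw [alt_len]; omega
  nmem h := alt_cc hcd _ (h1.isInfix.trans h)
  left := alt_left hcd _ h1
  right t ht hz hw := by
    refine alt_left (w := w.reverse) hcd.symm w.length ?_ t.reverse (by simpa using ht) ?_ ?_
    · simpa using List.reverse_prefix.mpr h2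
    · rw [← alt_rev]; simpa using hz
    · simpa using hw

theorem exists_sep_diff {c d : α} (hcd : c ≠ d) {w : List α} (h1 : [c] <+: w) (h2 : [d] <:+ w)
    (e1 : w ≠ List.replicate (w.length - 1) c ++ [d])
    (e2 : w ≠ c :: List.replicate (w.length - 1) d) : ∃ z, Sep w z := by
  by_cases hn : ∀ p q, w ≠ List.replicate p c ++ List.replicate q d
  · exact ⟨_, sep_diff hcd h1 h2 hn⟩
  · push Not at hn
    obtain ⟨p, q, rfl⟩ := hn
    refine ⟨_, sep_alt hcd ?_ ?_⟩
    · match p with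
      | 0 =>
        exfalso
        have : c ∈ List.replicate 0 c ++ List.replicate q d := h1.subset (by simp)
        exact hcd (List.eq_of_mem_replicate (by simpa using this))
      | 1 => exact absurd (by simp) e2
      | p + 2 => exact ⟨List.replicate p c ++ List.replicate q d, by simp [List.replicate_succ]⟩
    · match q with
      | 0 =>
        exfalso
        have : d ∈ List.replicate p c ++ List.replicate 0 d := h2.subset (by simp)
        simp only [List.replicate_zero, List.append_nil] at this
        exact hcd (List.eq_of_mem_replicate this).symm
      | 1 => exact absurd (by simp) e1
      | q + 2 =>
        exact ⟨List.replicate p c ++ List.replicate q d, by simp [List.replicate_succ']⟩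

theorem exists_sep (w : List Letter) (hw : w ≠ [])
    (h1 : w ≠ List.replicate (w.length - 1) Letter.a ++ [Letter.b])
    (h2 : w ≠ Letter.a :: List.replicate (w.length - 1) Letter.b)
    (h3 : w ≠ Letter.b :: List.replicate (w.length - 1) Letter.a)
    (h4 : w ≠ List.replicate (w.length - 1) Letter.b ++ [Letter.a]) : ∃ z, Sep w z := by
  have ha : [w.head hw] <+: w := ⟨w.tail, by simp⟩
  have hb : [w.getLast hw] <:+ w := ⟨w.dropLast, List.dropLast_append_getLast hw⟩
  generalize w.head hw = c at ha
  generalize w.getLast hw = d at hb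
  cases c <;> cases d
  · exact ⟨_, sep_same (d := Letter.b) (by simp) ha hb⟩
  · exact exists_sep_diff (by simp) ha hb h1 h2
  · exact exists_sep_diff (by simp) ha hb h4 h3
  · exact ⟨_, sep_same (d := Letter.a) (by simp) ha hb⟩

end SynFactor

/-- For w of length n with w ∉ {a^{n-1}b, ab^{n-1}, ba^{n-1}, b^{n-1}a}, the syntactic
complexity of L = Σ* w Σ* is n² + 1 + N(w), where N(w) is the number of distinct
inner factors of w. -/
theorem stmt12 (n : ℕ) (w : List Letter) (hlen : w.length = n)
    (h1 : w ≠ List.replicate (n - 1) Letter.a ++ [Letter.b])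
    (h2 : w ≠ Letter.a :: List.replicate (n - 1) Letter.b)
    (h3 : w ≠ Letter.b :: List.replicate (n - 1) Letter.a)
    (h4 : w ≠ List.replicate (n - 1) Letter.b ++ [Letter.a]) :
    syntacticComplexity (factorLang w) = n ^ 2 + 1 + (innerFactors w).ncard := by
  subst hlen
  by_cases hw : w = []
  · subst hw
    have hI : innerFactors [] = ∅ := by
      ext u
      simp only [innerFactors, Set.mem_ofPred_eq, Set.mem_empty_iff_false, iff_false]
      rintro ⟨hu, t, s, ht, hs, h⟩
      have h5 := congrArg List.length h
      have h6 := List.length_pos_iff.mpr ht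
      simp only [List.length_append, List.length_nil] at h5
      omega
    rw [hI]
    simp only [Set.ncard_empty, List.length_nil, syntacticComplexity]
    have : Nat.card (Quotient (synSetoid (factorLang []))) = 1 := by
      rw [Nat.card_eq_one_iff_unique]
      refine ⟨⟨?_⟩, ⟨Quotient.mk _ ⟨[Letter.a], by simp⟩⟩⟩
      intro u v
      induction u using Quotient.ind
      induction v using Quotient.ind
      apply Quotient.sound
      intro x y
      simp [factorLang]
    simpa using this
  · obtain ⟨z, hz⟩ := SynFactor.exists_sep w hw h1 h2 h3 h4
    exact SynFactor.card_main hw hz (synSetoid (factorLang w)) (fun u v => Iff.rfl) _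
      (fun u => Iff.rfl)
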